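/- Let m ≥ 1, p = 2, p1 = 3, p2 = 5, N = 3^m·5, and q = 2^{4·3^{m−1}}. Then for every k with 0 ≤ k ≤ 14, the Cayley graph Cay(F_q, D_k) is a strongly regular graph of degree (q−1)/15, where D_k = ∪_{i=0}^{3^{m−1}−1} C_{5i + k·3^{m−1}}. -/

import Mathlib

open scoped Classical

noncomputable section

/-- The absolute trace of an element of a field with `2 ^ f` elements, as a power sum. -/
def absTrace {F : Type} [Field F] (f : ℕ) (x : F) : F := ∑ i ∈ Finset.range f, x ^ 2 ^ i

section AbsTrace

variable {F : Type} [Field F] [Fintype F] [CharP F 2] {f : ℕ}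

theorem absTrace_add {F : Type} [Field F] [CharP F 2] {f : ℕ} (x y : F) :
    absTrace f (x + y) = absTrace f x + absTrace f y := by
  simp only [absTrace, add_pow_char_pow, Finset.sum_add_distrib]

theorem absTrace_sq {F : Type} [Field F] [Fintype F] {f : ℕ} (hF : Fintype.card F = 2 ^ f) (x : F) :
    absTrace f (x ^ 2) = absTrace f x := by
  have h1 := Finset.sum_range_succ (fun i => x ^ 2 ^ i) f
  have h2 := Finset.sum_range_succ' (fun i => x ^ 2 ^ i) f
  have h3 : x ^ 2 ^ f = x := by rw [← hF, FiniteField.pow_card]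
  rw [h3] at h1
  rw [h1] at h2
  simp only [pow_zero, pow_one, add_left_inj] at h2
  unfold absTrace
  rw [h2]
  refine Finset.sum_congr rfl fun i _ => ?_
  rw [← pow_mul, pow_succ']

theorem absTrace_eq_zero_or_one (hF : Fintype.card F = 2 ^ f) (x : F) :
    absTrace f x = 0 ∨ absTrace f x = 1 := by
  have h : absTrace f x ^ 2 = absTrace f x := by
    conv_rhs => rw [← absTrace_sq hF]
    simp only [absTrace, sum_pow_char]
    refine Finset.sum_congr rfl fun i _ => ?_
    rw [← pow_mul, ← pow_mul, mul_comm]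
  have h' : absTrace f x * (absTrace f x - 1) = 0 := by linear_combination h
  rcases mul_eq_zero.1 h' with h | h
  · exact Or.inl h
  · exact Or.inr (sub_eq_zero.1 h)

/-- The canonical additive character `x ↦ (-1) ^ Tr x` of a field of characteristic two. -/
def traceChar (hF : Fintype.card F = 2 ^ f) : AddChar F ℤ where
  toFun x := if absTrace f x = 0 then 1 else -1
  map_zero_eq_one' := by
    have : absTrace f (0 : F) = 0 := by
      refine Finset.sum_eq_zero fun i _ => ?_
      exact zero_pow (by positivity)
    simp [this]
  map_add_eq_mul' x y := by
    rw [absTrace_add]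
    rcases absTrace_eq_zero_or_one hF x with hx | hx <;>
    rcases absTrace_eq_zero_or_one hF y with hy | hy <;> simp [hx, hy, CharTwo.add_self_eq_zero]

theorem traceChar_apply (hF : Fintype.card F = 2 ^ f) (x : F) :
    traceChar hF x = if absTrace f x = 0 then 1 else -1 := rfl

theorem traceChar_sq (hF : Fintype.card F = 2 ^ f) (x : F) :
    traceChar hF (x ^ 2) = traceChar hF x := by
  simp only [traceChar_apply, absTrace_sq hF]

theorem sum_inv_mul_absTrace (hF : Fintype.card F = 2 ^ f) (hf : 2 ≤ f) :
    ∑ x : F, x⁻¹ * absTrace f x = 1 := by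
  simp only [absTrace, Finset.mul_sum]
  rw [Finset.sum_comm, Finset.sum_eq_single 0]
  · have : ∀ x : F, x⁻¹ * x ^ 2 ^ 0 = 1 - if x = 0 then 1 else 0 := by
      intro x
      by_cases hx : x = 0 <;> simp [hx]
    simp only [this, Finset.sum_sub_distrib]
    have h2 : (2 : F) = 0 := CharTwo.two_eq_zero
    simp [hF, h2, zero_pow (by omega : f ≠ 0), CharTwo.neg_eq]
  · intro i hi hi0
    have h1 : 2 ≤ 2 ^ i := Nat.le_self_pow hi0 2
    have : ∀ x : F, x⁻¹ * x ^ 2 ^ i = x ^ (2 ^ i - 1) := by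
      intro x
      by_cases hx : x = 0
      · simp [hx]
        rw [zero_pow (by omega)]
      · conv_lhs => rw [← Nat.sub_add_cancel (by omega : 1 ≤ 2 ^ i), pow_succ]
        field_simp
    simp only [this]
    apply FiniteField.sum_pow_lt_card_sub_one
    rw [hF]
    have : 2 ^ i < 2 ^ f := Nat.pow_lt_pow_right (by norm_num) (Finset.mem_range.1 hi)
    omega
  · intro h
    exact absurd (Finset.mem_range.2 (by omega)) h

theorem traceChar_ne_one (hF : Fintype.card F = 2 ^ f) (hf : 2 ≤ f) : traceChar hF ≠ 1 := by
  intro h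
  have h1 := sum_inv_mul_absTrace hF hf
  rw [Finset.sum_eq_zero] at h1
  · exact zero_ne_one h1
  · intro x _
    have := DFunLike.congr_fun h x
    rw [traceChar_apply, AddChar.one_apply] at this
    by_cases hx : absTrace f x = 0
    · simp [hx]
    · simp [hx] at this

end AbsTrace

section WittGauss

variable {F : Type} [Field F] [Fintype F] [CharP F 2] {f : ℕ}

/-- The Teichmüller character with values in the Witt vectors. -/
def teichChar (F : Type) [Field F] [Fintype F] : MulChar F (WittVector 2 F) where
  toMonoidHom := WittVector.teichmuller 2
  map_nonunit' a ha := by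
    have : a = 0 := by simpa using ha
    subst this
    exact WittVector.teichmuller_zero 2

theorem constantCoeff_teichChar {F : Type} [Field F] [Fintype F] (x : F) :
    WittVector.constantCoeff (teichChar F x) = x :=
  WittVector.teichmuller_coeff_zero 2 x

/-- The trace character with values in the Witt vectors. -/
def wittTraceChar (hF : Fintype.card F = 2 ^ f) : AddChar F (WittVector 2 F) :=
  (Int.castRingHom (WittVector 2 F)).toMonoidHom.compAddChar (traceChar hF)

theorem wittTraceChar_apply (hF : Fintype.card F = 2 ^ f) (x : F) :
    wittTraceChar hF x = (traceChar hF x : WittVector 2 F) := rfl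

theorem two_ne_zero_witt {F : Type} [Field F] [CharP F 2] : (2 : WittVector 2 F) ≠ 0 := by
  have := WittVector.p_nonzero 2 F
  exact_mod_cast this

theorem constantCoeff_two {F : Type} [Field F] [CharP F 2] :
    WittVector.constantCoeff (2 : WittVector 2 F) = (0 : F) := by
  rw [map_ofNat]
  exact CharTwo.two_eq_zero

/-- Divisibility of an integer by a power of two may be tested in the Witt vectors. -/
theorem two_pow_dvd_of_witt {F : Type} [Field F] [CharP F 2] (k : ℕ) (z : ℤ)
    (h : (2 : WittVector 2 F) ^ k ∣ (z : WittVector 2 F)) :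
    (2 : ℤ) ^ k ∣ z := by
  induction k generalizing z with
  | zero => simp
  | succ k ih =>
    have h0 : (2 : WittVector 2 F) ∣ (z : WittVector 2 F) := (dvd_pow_self 2 (by omega)).trans h
    have h1 : (2 : ℤ) ∣ z := by
      obtain ⟨c, hc⟩ := h0
      have := congrArg WittVector.constantCoeff hc
      rw [map_mul, constantCoeff_two, zero_mul, map_intCast] at this
      exact (CharP.intCast_eq_zero_iff F 2 z).1 this
    obtain ⟨w, rfl⟩ := h1
    rw [pow_succ'] at h ⊢
    push_cast at h
    exact mul_dvd_mul_left 2 (ih w ((mul_dvd_mul_iff_left two_ne_zero_witt).1 h))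

theorem charZero_witt {F : Type} [Field F] [CharP F 2] : CharZero (WittVector 2 F) := by
  refine charZero_of_inj_zero fun n hn => ?_
  by_contra h0
  have h := two_pow_dvd_of_witt (F := F) n (n : ℤ) (by simp [hn])
  have h2 : 2 ^ n ≤ n := Nat.le_of_dvd (by omega) (by exact_mod_cast h)
  exact absurd h2 (not_le.2 Nat.lt_two_pow_self)

/-- The Gauss sum of the `k`-th power of the inverse Teichmüller character. -/
def teichGauss (hF : Fintype.card F = 2 ^ f) (k : ℕ) : WittVector 2 F :=
  gaussSum ((teichChar F)⁻¹ ^ k) (wittTraceChar hF)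

theorem wittTraceChar_ne_one (hF : Fintype.card F = 2 ^ f) (hf : 2 ≤ f) :
    wittTraceChar hF ≠ 1 := by
  obtain ⟨x, hx⟩ := AddChar.ne_one_iff.1 (traceChar_ne_one hF hf)
  refine AddChar.ne_one_iff.2 ⟨x, ?_⟩
  rw [wittTraceChar_apply]
  have := charZero_witt (F := F)
  exact_mod_cast hx

theorem teichGauss_add_dvd (hF : Fintype.card F = 2 ^ f) (hf : 2 ≤ f) (a b : ℕ) :
    teichGauss hF (a + b) ∣ teichGauss hF a * teichGauss hF b := by
  unfold teichGauss
  rw [pow_add]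
  by_cases h : (teichChar F)⁻¹ ^ a * (teichChar F)⁻¹ ^ b = 1
  · rw [h, gaussSum_one_left (wittTraceChar_ne_one hF hf)]
    exact (isUnit_one.neg).dvd
  · exact Dvd.intro _ (jacobiSum_mul_nontrivial h _)

theorem teichGauss_two_mul (hF : Fintype.card F = 2 ^ f) (k : ℕ) :
    teichGauss hF (2 * k) = teichGauss hF k := by
  have hb : Function.Bijective (fun x : F => x ^ 2) := by
    apply Finite.injective_iff_bijective.1
    exact frobenius_inj F 2
  unfold teichGauss gaussSum
  rw [← hb.sum_comp (fun x => ((teichChar F)⁻¹ ^ k) x * wittTraceChar hF x)]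
  refine Finset.sum_congr rfl fun x _ => ?_
  rw [wittTraceChar_apply, wittTraceChar_apply, traceChar_sq, map_pow]
  congr 1
  by_cases hx : IsUnit x
  · rw [← hx.unit_spec, MulChar.pow_apply_coe, MulChar.pow_apply_coe, ← pow_mul, mul_comm]
  · have : x = 0 := by simpa using hx
    subst this
    rw [MulChar.map_zero, MulChar.map_zero, zero_pow two_ne_zero]

theorem teichGauss_zero (hF : Fintype.card F = 2 ^ f) (hf : 2 ≤ f) : teichGauss hF 0 = -1 := by
  unfold teichGauss
  rw [pow_zero, gaussSum_one_left (wittTraceChar_ne_one hF hf)]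

theorem teichChar_inv_ne_one {F : Type} [Field F] [Fintype F] {f : ℕ}
    (hF : Fintype.card F = 2 ^ f) (hf : 2 ≤ f) : (teichChar F)⁻¹ ≠ 1 := by
  intro h
  rw [inv_eq_one] at h
  have h1 : ∀ x : F, x ≠ 0 → x = 1 := by
    intro x hx
    rw [← constantCoeff_teichChar x, h, MulChar.one_apply (isUnit_iff_ne_zero.2 hx), map_one]
  have h2 : Fintype.card F ≤ 2 := by
    rw [← Finset.card_univ]
    refine (Finset.card_le_card (t := {0, 1}) fun x _ => ?_).trans Finset.card_le_two
    by_cases hx : x = 0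
    · simp [hx]
    · simp [h1 x hx]
  have h3 : 2 ^ 2 ≤ 2 ^ f := Nat.pow_le_pow_right (by norm_num) hf
  omega

theorem teichGauss_one (hF : Fintype.card F = 2 ^ f) (hf : 2 ≤ f) :
    ∃ u, IsUnit u ∧ teichGauss hF 1 = 2 * u := by
  have h0 : ∑ x : F, (teichChar F)⁻¹ x = 0 :=
    MulChar.sum_eq_zero_of_ne_one (teichChar_inv_ne_one hF hf)
  refine ⟨-∑ x : F, (teichChar F)⁻¹ x * if absTrace f x = 0 then 0 else 1, ?_, ?_⟩
  · refine (WittVector.isUnit_of_coeff_zero_ne_zero _ ?_).neg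
    change WittVector.constantCoeff _ ≠ (0 : F)
    have : ∀ x : F, WittVector.constantCoeff
        ((teichChar F)⁻¹ x * if absTrace f x = 0 then 0 else 1) = x⁻¹ * absTrace f x := by
      intro x
      rw [map_mul, MulChar.inv_apply', constantCoeff_teichChar]
      rcases absTrace_eq_zero_or_one hF x with h | h <;> simp [h]
    rw [map_sum, Finset.sum_congr rfl fun x _ => this x, sum_inv_mul_absTrace hF hf]
    exact one_ne_zero
  · unfold teichGauss gaussSum
    rw [pow_one, mul_neg, Finset.mul_sum, ← sub_eq_zero, sub_neg_eq_add, ← Finset.sum_add_distrib]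
    refine Eq.trans ?_ h0
    refine Finset.sum_congr rfl fun x _ => ?_
    rw [wittTraceChar_apply, traceChar_apply]
    split_ifs <;> push_cast <;> ring

theorem teichGauss_mul_of_add_eq (hF : Fintype.card F = 2 ^ f) (hf : 2 ≤ f) {a b : ℕ}
    (ha : (teichChar F)⁻¹ ^ a ≠ 1) (hab : (teichChar F)⁻¹ ^ (a + b) = 1) :
    teichGauss hF a * teichGauss hF b = 2 ^ f := by
  have hprim : (wittTraceChar hF).IsPrimitive :=
    AddChar.IsPrimitive.of_ne_one (wittTraceChar_ne_one hF hf)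
  have h := gaussSum_mul_gaussSum_eq_card ha hprim
  have hinv : (wittTraceChar hF)⁻¹ = wittTraceChar hF := by
    ext x
    rw [AddChar.inv_apply, CharTwo.neg_eq]
  have hb : ((teichChar F)⁻¹ ^ a)⁻¹ = (teichChar F)⁻¹ ^ b := by
    rw [pow_add] at hab
    exact inv_eq_of_mul_eq_one_right hab
  rw [hinv, hb] at h
  unfold teichGauss
  rw [h, hF]
  push_cast
  rfl

end WittGauss

theorem sum_range_mul_eq {M : Type*} [AddCommMonoid M] (g : ℕ → M) (N n : ℕ) :
    ∑ t ∈ Finset.range (N * n), g t =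
      ∑ e ∈ Finset.range N, ∑ t ∈ Finset.range n, g (e + N * t) := by
  rw [Finset.sum_comm]
  induction n with
  | zero => simp
  | succ n ih =>
    rw [Nat.mul_succ, Finset.sum_range_add, ih, Finset.sum_range_succ]
    simp only [add_comm]

section OrbitSums

theorem three_pow_dvd_of_dvd_sixteen_pow_sub_one (a d : ℕ) (h : 3 ^ (a + 1) ∣ 16 ^ d - 1) :
    3 ^ a ∣ d := by
  rcases Nat.eq_zero_or_pos d with rfl | hd
  · simp
  have h1 : emultiplicity 3 (16 ^ d - 1 ^ d) = emultiplicity 3 (16 - 1) + emultiplicity 3 d :=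
    Nat.emultiplicity_pow_sub_pow Nat.prime_three (by decide) (by norm_num) (by norm_num) d
  have h2 : emultiplicity 3 (16 - 1) = 1 := by
    rw [show 16 - 1 = 15 by norm_num]
    exact (emultiplicity_eq_coe (n := 1)).2 ⟨by norm_num, by norm_num⟩
  rw [one_pow, h2] at h1
  have h3 := le_emultiplicity_of_pow_dvd h
  rw [h1] at h3
  apply pow_dvd_of_le_emultiplicity
  rw [Nat.cast_add, add_comm] at h3
  exact (ENat.add_le_add_iff_left (by simp)).1 h3

theorem sixteen_pow_mul_mod_injOn (a c : ℕ) (hc : ¬ 3 ∣ c) :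
    Set.InjOn (fun t => 16 ^ t * c % (15 * 3 ^ a) / 15) (Finset.range (3 ^ a)) := by
  have key : ∀ t t' : ℕ, t ≤ t' → t' < 3 ^ a →
      16 ^ t * c % (15 * 3 ^ a) / 15 = 16 ^ t' * c % (15 * 3 ^ a) / 15 → t = t' := by
    intro t t' htt ht' h
    have hm : ∀ i : ℕ, 16 ^ i * c % (15 * 3 ^ a) % 15 = c % 15 := by
      intro i
      rw [Nat.mod_mul_right_mod, Nat.mul_mod, Nat.pow_mod]
      simp
    have he : 16 ^ t * c ≡ 16 ^ t' * c [MOD 15 * 3 ^ a] := by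
      unfold Nat.ModEq
      rw [← Nat.div_add_mod (16 ^ t * c % (15 * 3 ^ a)) 15,
        ← Nat.div_add_mod (16 ^ t' * c % (15 * 3 ^ a)) 15, hm, hm, h]
    have h1 := (Nat.modEq_iff_dvd' (Nat.mul_le_mul_right c
      (Nat.pow_le_pow_right (by norm_num) htt))).1 he
    have h2 : 16 ^ t' * c - 16 ^ t * c = 16 ^ t * c * (16 ^ (t' - t) - 1) := by
      rw [Nat.mul_sub, mul_one]
      congr 1
      conv_lhs => rw [← Nat.add_sub_cancel' htt, pow_add]
      ring
    have h3 : 3 ^ (a + 1) ∣ 16 ^ t * c * (16 ^ (t' - t) - 1) := by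
      rw [← h2]
      refine Dvd.dvd.trans ⟨5, ?_⟩ h1
      ring
    have hcop : Nat.Coprime (3 ^ (a + 1)) (16 ^ t * c) := by
      refine Nat.Coprime.mul_right ?_ ?_
      · exact Nat.Coprime.pow _ _ (by norm_num)
      · exact Nat.Coprime.pow_left _ ((Nat.Prime.coprime_iff_not_dvd Nat.prime_three).2 hc)
    have h4 := three_pow_dvd_of_dvd_sixteen_pow_sub_one a _ (hcop.dvd_of_dvd_mul_left h3)
    have h5 := Nat.eq_zero_of_dvd_of_lt h4 (by omega)
    omega
  intro t ht t' ht' h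
  rw [Finset.coe_range, Set.mem_Iio] at ht ht'
  rcases le_total t t' with hle | hle
  · exact key t t' hle ht' h
  · exact (key t' t hle ht h.symm).symm

theorem sum_sixteen_pow_mul_mod (a c : ℕ) (hc : ¬ 3 ∣ c) :
    ∑ t ∈ Finset.range (3 ^ a), 16 ^ t * c % (15 * 3 ^ a) =
      3 ^ a * (c % 15) + 15 * ∑ t ∈ Finset.range (3 ^ a), t := by
  have hm : ∀ i : ℕ, 16 ^ i * c % (15 * 3 ^ a) % 15 = c % 15 := by
    intro i
    rw [Nat.mod_mul_right_mod, Nat.mul_mod, Nat.pow_mod]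
    simp
  have himg : (Finset.range (3 ^ a)).image (fun t => 16 ^ t * c % (15 * 3 ^ a) / 15) =
      Finset.range (3 ^ a) := by
    refine Finset.eq_of_subset_of_card_le ?_ ?_
    · intro x hx
      obtain ⟨t, -, rfl⟩ := Finset.mem_image.1 hx
      rw [Finset.mem_range]
      exact Nat.div_lt_of_lt_mul (Nat.mod_lt _ (by positivity))
    · rw [Finset.card_image_of_injOn (sixteen_pow_mul_mod_injOn a c hc)]
  conv_rhs => rw [← himg, Finset.sum_image (sixteen_pow_mul_mod_injOn a c hc)]
  rw [Finset.mul_sum]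
  have hcst : 3 ^ a * (c % 15) = ∑ t ∈ Finset.range (3 ^ a), c % 15 := by simp
  rw [hcst, ← Finset.sum_add_distrib]
  refine Finset.sum_congr rfl fun t _ => ?_
  conv_lhs => rw [← Nat.div_add_mod (16 ^ t * c % (15 * 3 ^ a)) 15, hm]
  ring

theorem sum_two_pow_mul_mod_le (a j : ℕ) (hj : ¬ 3 ∣ j) :
    ∑ l ∈ Finset.range (4 * 3 ^ a), 2 ^ l * j % (15 * 3 ^ a) ≤ 15 * 3 ^ a * (2 * 3 ^ a + 1) := by
  rw [sum_range_mul_eq]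
  have h : ∀ e ∈ Finset.range 4, ∑ t ∈ Finset.range (3 ^ a), 2 ^ (e + 4 * t) * j % (15 * 3 ^ a) =
      3 ^ a * (2 ^ e * j % 15) + 15 * ∑ t ∈ Finset.range (3 ^ a), t := by
    intro e _
    rw [← sum_sixteen_pow_mul_mod a (2 ^ e * j)]
    · refine Finset.sum_congr rfl fun t _ => ?_
      rw [pow_add, pow_mul]
      norm_num
      ring_nf
    · intro h
      rcases (Nat.Prime.dvd_mul Nat.prime_three).1 h with h | h
      · exact absurd (Nat.Prime.dvd_of_dvd_pow Nat.prime_three h) (by norm_num)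
      · exact hj h
  rw [Finset.sum_congr rfl h, Finset.sum_add_distrib, ← Finset.mul_sum, Finset.sum_const,
    Finset.card_range]
  have h45 : ∑ e ∈ Finset.range 4, 2 ^ e * j % 15 ≤ 45 := by
    simp only [Finset.sum_range_succ, Finset.sum_range_zero]
    omega
  have hg := Finset.sum_range_id_mul_two (3 ^ a)
  have hp : 1 ≤ 3 ^ a := Nat.one_le_pow _ _ (by norm_num)
  generalize 3 ^ a = T at *
  obtain ⟨T, rfl⟩ := Nat.exists_eq_add_of_le hp
  rw [Nat.add_sub_cancel_left] at hg
  simp only [smul_eq_mul]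
  nlinarith

end OrbitSums

section WittGauss

variable {F : Type} [Field F] [Fintype F] [CharP F 2] {f : ℕ}

/-- Building the binary expansion of `2 ^ i * j / N` digit by digit bounds the corresponding
Gauss sum by a power of the first one. -/
theorem teichGauss_two_pow_mul_div_dvd (hF : Fintype.card F = 2 ^ f) (hf : 2 ≤ f) (N j : ℕ)
    (hj : j < N) (i : ℕ) :
    ∃ S, teichGauss hF (2 ^ i * j / N) ∣ teichGauss hF 1 ^ S ∧
      N * S + 2 ^ i * j % N = ∑ l ∈ Finset.range i, 2 ^ l * j % N + j := by
  induction i with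
  | zero =>
    refine ⟨0, ?_, ?_⟩
    · rw [pow_zero, one_mul, Nat.div_eq_of_lt hj, teichGauss_zero hF hf]
      exact isUnit_one.neg.dvd
    · simp [Nat.mod_eq_of_lt hj]
  | succ i ih =>
    obtain ⟨S, hS, hsum⟩ := ih
    have hN : 0 < N := by omega
    set R := 2 ^ i * j % N with hR
    set K := 2 ^ i * j / N with hK
    have hRlt : R < N := Nat.mod_lt _ hN
    have hx : 2 ^ (i + 1) * j = N * (2 * K) + 2 * R := by
      have := Nat.div_add_mod (2 ^ i * j) N
      rw [pow_succ, mul_assoc, mul_comm 2 j, ← mul_assoc, ← this]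
      ring
    have hdiv : 2 ^ (i + 1) * j / N = 2 * K + 2 * R / N := by
      rw [hx, Nat.mul_add_div hN]
    have hmod : 2 ^ (i + 1) * j % N = 2 * R % N := by
      rw [hx, Nat.mul_add_mod]
    have hdm := Nat.div_add_mod (2 * R) N
    have hd : 2 * R / N < 2 := Nat.div_lt_of_lt_mul (by omega)
    refine ⟨S + 2 * R / N, ?_, ?_⟩
    · rw [hdiv, pow_add]
      refine (teichGauss_add_dvd hF hf _ _).trans (mul_dvd_mul ?_ ?_)
      · rw [teichGauss_two_mul]
        exact hS
      · interval_cases 2 * R / N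
        · rw [teichGauss_zero hF hf]
          exact isUnit_one.neg.dvd
        · rw [pow_one]
    · rw [Finset.sum_range_succ, hmod, ← hR, mul_add]
      omega

theorem teichChar_inv_pow_ne_one {F : Type} [Field F] [Fintype F] (γ : Fˣ) {k : ℕ} (hk : ¬ orderOf γ ∣ k) :
    (teichChar F)⁻¹ ^ k ≠ 1 := by
  intro h
  apply hk
  rw [orderOf_dvd_iff_pow_eq_one]
  have h1 : ((teichChar F)⁻¹ ^ k) (γ : F) = 1 := by rw [h, MulChar.one_apply_coe]
  rw [MulChar.pow_apply_coe, MulChar.inv_apply', ← map_pow] at h1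
  have h2 := congrArg WittVector.constantCoeff h1
  rw [constantCoeff_teichChar, map_one, inv_pow, inv_eq_one] at h2
  ext
  simpa using h2

theorem two_pow_dvd_teichGauss (a : ℕ) (hF : Fintype.card F = 2 ^ (4 * 3 ^ a)) (γ : Fˣ)
    (hγ : orderOf γ = 2 ^ (4 * 3 ^ a) - 1) (n : ℕ) (hn : 15 * 3 ^ a * n = 2 ^ (4 * 3 ^ a) - 1)
    (j : ℕ) (hj : j < 15 * 3 ^ a) (hj3 : ¬ 3 ∣ j) :
    2 ^ (2 * 3 ^ a - 1) ∣ teichGauss hF (n * j) := by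
  have hT : 1 ≤ 3 ^ a := Nat.one_le_pow _ _ (by norm_num)
  have hf : 2 ≤ 4 * 3 ^ a := by omega
  have hq : 2 ^ 2 ≤ 2 ^ (4 * 3 ^ a) := Nat.pow_le_pow_right (by norm_num) hf
  have hbound := sum_two_pow_mul_mod_le a (15 * 3 ^ a - j)
    (by intro h; apply hj3; have h2 : 3 ∣ 15 * 3 ^ a := ⟨5 * 3 ^ a, by ring⟩; omega)
  have hj0 : 0 < j := Nat.pos_of_ne_zero (by rintro rfl; simp at hj3)
  obtain ⟨S, hS, hsum⟩ := teichGauss_two_pow_mul_div_dvd hF hf (15 * 3 ^ a) (15 * 3 ^ a - j)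
    (by omega) (4 * 3 ^ a)
  have hqeq : 2 ^ (4 * 3 ^ a) = 15 * 3 ^ a * n + 1 := by omega
  have hn0 : 0 < n := Nat.pos_of_ne_zero (by rintro rfl; omega)
  have hx : 2 ^ (4 * 3 ^ a) * (15 * 3 ^ a - j) =
      15 * 3 ^ a * (n * (15 * 3 ^ a - j)) + (15 * 3 ^ a - j) := by
    rw [hqeq]; ring
  rw [hx, Nat.mul_add_mod, Nat.mod_eq_of_lt (by omega : 15 * 3 ^ a - j < 15 * 3 ^ a)] at hsum
  rw [hx, Nat.mul_add_div (by omega), Nat.div_eq_of_lt (by omega), add_zero] at hS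
  have hSle : S ≤ 2 * 3 ^ a + 1 := by
    have : 15 * 3 ^ a * S ≤ 15 * 3 ^ a * (2 * 3 ^ a + 1) := by omega
    exact Nat.le_of_mul_le_mul_left this (by omega)
  obtain ⟨u, hu, hg1⟩ := teichGauss_one hF hf
  obtain ⟨Y, hY⟩ := hS.trans (pow_dvd_pow _ hSle)
  have hprod : teichGauss hF (n * j) * teichGauss hF (n * (15 * 3 ^ a - j)) =
      2 ^ (4 * 3 ^ a) := by
    apply teichGauss_mul_of_add_eq hF hf
    · apply teichChar_inv_pow_ne_one γ
      rw [hγ, ← hn, mul_comm, Nat.mul_dvd_mul_iff_left hn0]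
      exact fun h => absurd (Nat.le_of_dvd hj0 h) (by omega)
    · rw [← mul_add, Nat.add_sub_cancel' hj.le, mul_comm, hn, ← hF, ← Nat.card_eq_fintype_card,
        ← Nat.card_units, Nat.card_eq_fintype_card, MulChar.pow_card_eq_one]
  rw [hg1, mul_pow] at hY
  have hcalc : 2 ^ (2 * 3 ^ a + 1) * (teichGauss hF (n * j) * u ^ (2 * 3 ^ a + 1)) =
      2 ^ (2 * 3 ^ a + 1) * (2 ^ (2 * 3 ^ a - 1) * Y) := by
    rw [← mul_assoc _ _ Y, ← pow_add, show 2 * 3 ^ a + 1 + (2 * 3 ^ a - 1) = 4 * 3 ^ a by omega,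
      ← hprod]
    linear_combination teichGauss hF (n * j) * hY
  have h := mul_left_cancel₀ (pow_ne_zero _ two_ne_zero_witt) hcalc
  rw [← (hu.pow (2 * 3 ^ a + 1)).dvd_mul_right, h]
  exact Dvd.intro _ rfl

end WittGauss

section GaussPeriods

variable {F : Type} [Field F]

/-- The Gauss period of the coset `γ ^ s * ⟨γ ^ N⟩`, where `γ ^ N` has order `n`. -/
def gaussPeriod (ψ : AddChar F ℤ) (γ : Fˣ) (N n s : ℕ) : ℤ :=
  ∑ t ∈ Finset.range n, ψ ((γ : F) ^ (s + N * t))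

theorem sum_range_generator_pow [Fintype F] {M : Type*} [AddCommMonoid M] (γ : Fˣ) {k : ℕ}
    (hγ : orderOf γ = k) (hF : Fintype.card F = k + 1) (g : F → M) :
    ∑ x, g x = g 0 + ∑ t ∈ Finset.range k, g ((γ : F) ^ t) := by
  have hinj : Set.InjOn (fun t => (γ : F) ^ t) (Finset.range k) := by
    intro t ht t' ht' h
    rw [Finset.coe_range, Set.mem_Iio, ← hγ] at ht ht'
    refine pow_injOn_Iio_orderOf ht ht' ?_
    ext
    simpa using h
  have himg : (Finset.range k).image (fun t => (γ : F) ^ t) = Finset.univ.erase 0 := by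
    refine Finset.eq_of_subset_of_card_le ?_ ?_
    · intro x hx
      obtain ⟨t, -, rfl⟩ := Finset.mem_image.1 hx
      simp
    · rw [Finset.card_image_of_injOn hinj, Finset.card_erase_of_mem (Finset.mem_univ 0),
        Finset.card_univ, hF]
      simp
  rw [← Finset.add_sum_erase _ _ (Finset.mem_univ (0 : F)), ← himg, Finset.sum_image hinj]

variable {ψ : AddChar F ℤ} {γ : Fˣ} {N n : ℕ}

theorem generator_pow_add_mul (hγ : orderOf γ = N * n) (s k : ℕ) :
    (γ : F) ^ (s + N * n * k) = (γ : F) ^ s := by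
  have h : (γ : F) ^ (N * n) = 1 := by
    rw [← hγ, ← Units.val_pow_eq_pow_val, pow_orderOf_eq_one, Units.val_one]
  rw [pow_add, pow_mul, h, one_pow, mul_one]

theorem gaussPeriod_add_mul (hγ : orderOf γ = N * n) (s k : ℕ) :
    gaussPeriod ψ γ N n (s + N * k) = gaussPeriod ψ γ N n s := by
  induction k with
  | zero => simp
  | succ k ih =>
    rw [← ih]
    unfold gaussPeriod
    have h1 := Finset.sum_range_succ (fun t => ψ ((γ : F) ^ (s + N * k + N * t))) n
    have h2 := Finset.sum_range_succ' (fun t => ψ ((γ : F) ^ (s + N * k + N * t))) n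
    have h3 := generator_pow_add_mul hγ (s + N * k) 1
    rw [mul_one] at h3
    rw [h1, h3, mul_zero, add_zero, add_left_inj] at h2
    rw [h2]
    refine Finset.sum_congr rfl fun t _ => ?_
    congr 2
    ring

theorem gaussPeriod_mod (hγ : orderOf γ = N * n) (s : ℕ) :
    gaussPeriod ψ γ N n (s % N) = gaussPeriod ψ γ N n s := by
  conv_rhs => rw [← Nat.mod_add_div s N, gaussPeriod_add_mul hγ]

theorem gaussPeriod_two_mul (hγ : orderOf γ = N * n) (hn : Odd n)
    (hψ : ∀ x, ψ (x ^ 2) = ψ x) (s : ℕ) :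
    gaussPeriod ψ γ N n (2 * s) = gaussPeriod ψ γ N n s := by
  have hinj : Set.InjOn (fun t => 2 * t % n) (Finset.range n) := by
    intro t ht t' ht' h
    rw [Finset.coe_range, Set.mem_Iio] at ht ht'
    have h2 : t ≡ t' [MOD n] := Nat.ModEq.cancel_left_of_coprime
      (Nat.coprime_comm.1 (Nat.coprime_two_left.2 hn)) h
    exact Nat.ModEq.eq_of_lt_of_lt h2 ht ht'
  have himg : (Finset.range n).image (fun t => 2 * t % n) = Finset.range n := by
    refine Finset.eq_of_subset_of_card_le ?_ (Finset.card_image_of_injOn hinj).ge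
    intro x hx
    obtain ⟨t, ht, rfl⟩ := Finset.mem_image.1 hx
    rw [Finset.mem_range] at ht ⊢
    exact Nat.mod_lt _ (by omega)
  unfold gaussPeriod
  rw [← himg, Finset.sum_image hinj, himg]
  refine Finset.sum_congr rfl fun t _ => ?_
  rw [← hψ ((γ : F) ^ (s + N * t)), ← pow_mul,
    ← generator_pow_add_mul hγ (2 * s + N * (2 * t % n)) (2 * t / n)]
  congr 2
  have := Nat.mod_add_div (2 * t) n
  linear_combination N * this

theorem gaussPeriod_two_pow_mul (hγ : orderOf γ = N * n) (hn : Odd n)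
    (hψ : ∀ x, ψ (x ^ 2) = ψ x) (i s : ℕ) :
    gaussPeriod ψ γ N n (2 ^ i * s) = gaussPeriod ψ γ N n s := by
  induction i with
  | zero => simp
  | succ i ih => rw [pow_succ', mul_assoc, gaussPeriod_two_mul hγ hn hψ, ih]

variable [Fintype F]

theorem sum_gaussPeriod (hγ : orderOf γ = N * n) (hF : Fintype.card F = N * n + 1)
    (hψ : ψ ≠ 1) : ∑ e ∈ Finset.range N, gaussPeriod ψ γ N n e = -1 := by
  have h := sum_range_generator_pow γ hγ hF ψ
  rw [AddChar.sum_eq_zero_of_ne_one hψ, sum_range_mul_eq, AddChar.map_zero_eq_one] at h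
  unfold gaussPeriod
  linarith

theorem sum_gaussPeriod_mul_shift [CharP F 2] (hγ : orderOf γ = N * n)
    (hF : Fintype.card F = N * n + 1) (hψ : ψ ≠ 1) (d : ℕ) :
    ∑ e ∈ Finset.range N, gaussPeriod ψ γ N n e * gaussPeriod ψ γ N n (e + d) =
      ∑ t ∈ Finset.range n, if (γ : F) ^ (d + N * t) = 1 then (N * n : ℤ) else -1 := by
  have h1 : ∀ e, gaussPeriod ψ γ N n e * gaussPeriod ψ γ N n (e + d) =
      ∑ t ∈ Finset.range n, ψ ((γ : F) ^ (e + N * t)) * gaussPeriod ψ γ N n (e + N * t + d) := by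
    intro e
    rw [gaussPeriod, Finset.sum_mul]
    refine Finset.sum_congr rfl fun t _ => ?_
    rw [add_right_comm, gaussPeriod_add_mul hγ]
  simp only [h1]
  rw [← sum_range_mul_eq (fun j => ψ ((γ : F) ^ j) * gaussPeriod ψ γ N n (j + d))]
  simp only [gaussPeriod, Finset.mul_sum]
  rw [Finset.sum_comm]
  refine Finset.sum_congr rfl fun t _ => ?_
  have h2 : ∀ j : ℕ, ψ ((γ : F) ^ j) * ψ ((γ : F) ^ (j + d + N * t)) =
      ψ ((γ : F) ^ j * (1 + (γ : F) ^ (d + N * t))) := by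
    intro j
    rw [← AddChar.map_add_eq_mul]
    congr 1
    ring
  simp only [h2]
  have h3 := sum_range_generator_pow γ hγ hF (fun x => ψ (x * (1 + (γ : F) ^ (d + N * t))))
  rw [AddChar.sum_mulShift _ (AddChar.IsPrimitive.of_ne_one hψ), zero_mul,
    AddChar.map_zero_eq_one, CharTwo.add_eq_zero, hF] at h3
  rw [eq_comm] at h3
  simp only [eq_comm (a := (1 : F))] at h3
  split_ifs at h3 ⊢ <;> push_cast at h3 <;> linarith

theorem sum_gaussPeriod_sq [CharP F 2] (hγ : orderOf γ = N * n)
    (hF : Fintype.card F = N * n + 1) (hψ : ψ ≠ 1) (hN : 0 < N) (hn : 0 < n) :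
    ∑ e ∈ Finset.range N, gaussPeriod ψ γ N n e ^ 2 = N * n + 1 - n := by
  have h := sum_gaussPeriod_mul_shift hγ hF hψ 0
  simp only [add_zero, zero_add, ← sq] at h
  rw [h]
  have h1 : ∀ t ∈ Finset.range n, (if (γ : F) ^ (N * t) = 1 then (N * n : ℤ) else -1) =
      (if t = 0 then (N * n + 1 : ℤ) else 0) - 1 := by
    intro t ht
    rw [Finset.mem_range] at ht
    have : (γ : F) ^ (N * t) = 1 ↔ t = 0 := by
      rw [← Units.val_pow_eq_pow_val, Units.val_eq_one, ← orderOf_dvd_iff_pow_eq_one, hγ,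
        Nat.mul_dvd_mul_iff_left hN]
      exact ⟨fun h => Nat.eq_zero_of_dvd_of_lt h ht, by rintro rfl; simp⟩
    simp only [this]
    split_ifs <;> ring
  rw [Finset.sum_congr rfl h1, Finset.sum_sub_distrib, Finset.sum_ite_eq',
    if_pos (Finset.mem_range.2 hn)]
  simp

theorem sum_gaussPeriod_mul_shift_of_not_dvd [CharP F 2] (hγ : orderOf γ = N * n)
    (hF : Fintype.card F = N * n + 1) (hψ : ψ ≠ 1) {d : ℕ} (hd : ¬ N ∣ d) :
    ∑ e ∈ Finset.range N, gaussPeriod ψ γ N n e * gaussPeriod ψ γ N n (e + d) = -n := by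
  rw [sum_gaussPeriod_mul_shift hγ hF hψ]
  have h1 : ∀ t ∈ Finset.range n,
      (if (γ : F) ^ (d + N * t) = 1 then (N * n : ℤ) else -1) = -1 := by
    intro t _
    rw [if_neg]
    rw [← Units.val_pow_eq_pow_val, Units.val_eq_one, ← orderOf_dvd_iff_pow_eq_one, hγ]
    exact fun h => hd ((Nat.dvd_add_left (dvd_mul_right N t)).1 ((dvd_mul_right N n).trans h))
  rw [Finset.sum_congr rfl h1]
  simp

theorem sum_range_shift_of_periodic {M : Type*} [AddCommMonoid M] (g : ℕ → M) (N d : ℕ)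
    (hg : ∀ s, g (s + N) = g s) :
    ∑ e ∈ Finset.range N, g (e + d) = ∑ e ∈ Finset.range N, g e := by
  induction d with
  | zero => simp
  | succ d ih =>
    have h := Finset.sum_range_succ' (fun e => g (e + d)) N
    rw [Finset.sum_range_succ, zero_add, add_comm N d, hg] at h
    rw [← ih]
    rcases Nat.eq_zero_or_pos N with rfl | hN
    · simp
    obtain ⟨N, rfl⟩ := Nat.exists_eq_add_of_le' hN
    rw [Finset.sum_range_succ, Finset.sum_range_succ', show N + (d + 1) = d + (N + 1) by ring,
      hg, zero_add]
    simp only [add_assoc, add_comm 1 d]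

theorem sum_sq_gaussPeriod_sub_shift [CharP F 2] (hγ : orderOf γ = N * n)
    (hF : Fintype.card F = N * n + 1) (hψ : ψ ≠ 1) (hN : 0 < N) (hn : 0 < n) {d : ℕ}
    (hd : ¬ N ∣ d) :
    ∑ e ∈ Finset.range N, (gaussPeriod ψ γ N n e - gaussPeriod ψ γ N n (e + d)) ^ 2 =
      2 * (N * n + 1) := by
  have h1 := sum_gaussPeriod_sq hγ hF hψ hN hn
  have h2 := sum_gaussPeriod_mul_shift_of_not_dvd hγ hF hψ hd
  have h3 := sum_range_shift_of_periodic (fun e => gaussPeriod ψ γ N n e ^ 2) N d fun s => by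
    have := gaussPeriod_add_mul (ψ := ψ) hγ s 1
    rw [mul_one] at this
    simp only [this]
  have h4 : ∀ e, (gaussPeriod ψ γ N n e - gaussPeriod ψ γ N n (e + d)) ^ 2 =
      gaussPeriod ψ γ N n e ^ 2 + gaussPeriod ψ γ N n (e + d) ^ 2 -
        2 * (gaussPeriod ψ γ N n e * gaussPeriod ψ γ N n (e + d)) := fun e => by ring
  simp only [h4, Finset.sum_sub_distrib, Finset.sum_add_distrib, ← Finset.mul_sum]
  rw [h3, h1, h2]
  ring

end GaussPeriods

section Fourier

theorem geom_sum_eq_ite {R : Type*} [CommRing R] [IsDomain R] {ζ : R} {N : ℕ} (h : ζ ^ N = 1) :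
    ∑ j ∈ Finset.range N, ζ ^ j = if ζ = 1 then (N : R) else 0 := by
  split_ifs with h1
  · simp [h1]
  · have h2 := geom_sum_mul ζ N
    rw [h, sub_self] at h2
    exact (mul_eq_zero.1 h2).resolve_right (sub_ne_zero.2 h1)

variable {F : Type} [Field F] [Fintype F] [CharP F 2] {f N n : ℕ} {γ : Fˣ}

theorem sum_mul_teichGauss (hF : Fintype.card F = 2 ^ f) (hγ : orderOf γ = N * n)
    (hcard : Fintype.card F = N * n + 1) (hN : 0 < N) (hn : 0 < n) (c s : ℕ) (hcs : N ∣ c + s) :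
    ∑ j ∈ Finset.range N, (teichChar F)⁻¹ γ ^ (n * j * c) * teichGauss hF (n * j) =
      N * (gaussPeriod (traceChar hF) γ N n s : WittVector 2 F) := by
  set θ := (teichChar F)⁻¹ γ with hθ
  have hpow : ∀ k, θ ^ k = 1 ↔ N * n ∣ k := by
    intro k
    rw [← hγ, orderOf_dvd_iff_pow_eq_one, hθ, ← map_pow, ← Units.val_pow_eq_pow_val]
    constructor
    · intro h
      have h2 := congrArg WittVector.constantCoeff h
      rw [MulChar.inv_apply', constantCoeff_teichChar, map_one, inv_eq_one] at h2
      exact Units.val_eq_one.1 h2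
    · intro h
      rw [h, Units.val_one, map_one]
  have hg : ∀ j, teichGauss hF (n * j) =
      ∑ t ∈ Finset.range (N * n), θ ^ (n * j * t) * wittTraceChar hF ((γ : F) ^ t) := by
    intro j
    unfold teichGauss gaussSum
    rw [sum_range_generator_pow γ hγ hcard, MulChar.map_zero, zero_mul, zero_add]
    refine Finset.sum_congr rfl fun t _ => ?_
    rw [← Units.val_pow_eq_pow_val, MulChar.pow_apply_coe, Units.val_pow_eq_pow_val, map_pow,
      ← pow_mul, mul_comm t]
  have hgeom : ∀ k, ∑ j ∈ Finset.range N, θ ^ (n * j * k) =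
      if N ∣ k then (N : WittVector 2 F) else 0 := by
    intro k
    have h1 : ∀ j, θ ^ (n * j * k) = (θ ^ (n * k)) ^ j := fun j => by
      rw [← pow_mul]; congr 1; ring
    have h2 : θ ^ (n * k) = 1 ↔ N ∣ k := by
      rw [hpow, mul_comm N n, Nat.mul_dvd_mul_iff_left hn]
    simp only [h1]
    rw [geom_sum_eq_ite (by rw [← pow_mul, hpow]; exact ⟨k, by ring⟩)]
    simp only [h2]
  have hswap : ∑ j ∈ Finset.range N, θ ^ (n * j * c) * teichGauss hF (n * j) =
      ∑ t ∈ Finset.range (N * n), (if N ∣ c + t then (N : WittVector 2 F) else 0) *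
        wittTraceChar hF ((γ : F) ^ t) := by
    simp only [hg, Finset.mul_sum, ← hgeom, Finset.sum_mul]
    rw [Finset.sum_comm]
    refine Finset.sum_congr rfl fun t _ => Finset.sum_congr rfl fun j _ => ?_
    rw [mul_add, pow_add]
    exact (mul_assoc _ _ _).symm
  rw [hswap, sum_range_mul_eq, Finset.sum_eq_single (s % N)]
  · rw [← gaussPeriod_mod hγ, gaussPeriod, Int.cast_sum, Finset.mul_sum]
    refine Finset.sum_congr rfl fun t _ => ?_
    rw [if_pos, wittTraceChar_apply]
    rw [← add_assoc]
    refine dvd_add ?_ (dvd_mul_right N t)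
    rw [Nat.dvd_iff_mod_eq_zero, Nat.add_mod_mod]
    exact Nat.mod_eq_zero_of_dvd hcs
  · intro e he hne
    refine Finset.sum_eq_zero fun t _ => ?_
    rw [if_neg, zero_mul]
    intro h
    rw [← add_assoc] at h
    have h1 := (Nat.dvd_add_left (dvd_mul_right N t)).1 h
    apply hne
    have h2 : c + e ≡ c + s [MOD N] :=
      (Nat.modEq_zero_iff_dvd.2 h1).trans (Nat.modEq_zero_iff_dvd.2 hcs).symm
    have h3 := Nat.ModEq.add_left_cancel' c h2
    rw [← Nat.mod_eq_of_lt (Finset.mem_range.1 he)]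
    exact h3
  · intro h
    exact absurd (Finset.mem_range.2 (Nat.mod_lt _ hN)) h

theorem two_pow_dvd_gaussPeriod_sub (a : ℕ) (hF : Fintype.card F = 2 ^ (4 * 3 ^ a))
    (hγ : orderOf γ = 15 * 3 ^ a * n) (hcard : Fintype.card F = 15 * 3 ^ a * n + 1)
    (hn : 0 < n) (s : ℕ) :
    (2 : ℤ) ^ (2 * 3 ^ a - 1) ∣ gaussPeriod (traceChar hF) γ (15 * 3 ^ a) n s -
      gaussPeriod (traceChar hF) γ (15 * 3 ^ a) n (s + 5 * 3 ^ a) := by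
  have hN : 0 < 15 * 3 ^ a := by positivity
  have h1 := sum_mul_teichGauss hF hγ hcard hN hn (14 * 3 ^ a * s + (3 ^ a - 1) * s) s ⟨s, by
    have : 1 ≤ 3 ^ a := Nat.one_le_pow _ _ (by norm_num)
    obtain ⟨T, hT⟩ := Nat.exists_eq_add_of_le this
    rw [hT, Nat.add_sub_cancel_left]
    ring⟩
  have h2 := sum_mul_teichGauss hF hγ hcard hN hn
    (14 * 3 ^ a * s + (3 ^ a - 1) * s + 10 * 3 ^ a) (s + 5 * 3 ^ a) ⟨s + 1, by
    have : 1 ≤ 3 ^ a := Nat.one_le_pow _ _ (by norm_num)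
    obtain ⟨T, hT⟩ := Nat.exists_eq_add_of_le this
    rw [hT, Nat.add_sub_cancel_left]
    ring⟩
  generalize 14 * 3 ^ a * s + (3 ^ a - 1) * s = c at h1 h2
  have hcop : IsCoprime ((2 : ℤ) ^ (2 * 3 ^ a - 1)) (15 * 3 ^ a : ℕ) := by
    apply IsCoprime.pow_left
    rw [show (2 : ℤ) = (2 : ℕ) by rfl, Nat.isCoprime_iff_coprime, Nat.coprime_two_left]
    exact Odd.mul (by decide) (Odd.pow (by decide))
  refine hcop.dvd_of_dvd_mul_left (two_pow_dvd_of_witt (F := F) _ _ ?_)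
  rw [Int.cast_mul, Int.cast_sub, Int.cast_natCast, mul_sub, ← h1, ← h2, ← Finset.sum_sub_distrib]
  refine Finset.dvd_sum fun j hj => ?_
  rw [← sub_mul]
  by_cases hj3 : 3 ∣ j
  · obtain ⟨i, rfl⟩ := hj3
    have : (teichChar F)⁻¹ (γ : F) ^ (n * (3 * i) * (c + 10 * 3 ^ a)) =
        (teichChar F)⁻¹ γ ^ (n * (3 * i) * c) := by
      rw [← map_pow, ← map_pow, show n * (3 * i) * (c + 10 * 3 ^ a) =
        n * (3 * i) * c + 15 * 3 ^ a * n * (2 * i) by ring, generator_pow_add_mul hγ]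
    rw [this, sub_self, zero_mul]
    exact dvd_zero _
  · refine Dvd.dvd.mul_left (two_pow_dvd_teichGauss a hF γ ?_ n ?_ j (Finset.mem_range.1 hj) hj3) _
    · omega
    · omega

end Fourier

section TwoValues

theorem exists_sixteen_pow_three_pow_eq (b : ℕ) :
    ∃ v, 16 ^ 3 ^ b = 1 + 5 * 3 ^ (b + 1) * (3 * v + 1) := by
  induction b with
  | zero => exact ⟨0, by norm_num⟩
  | succ b ih =>
    obtain ⟨v, hv⟩ := ih
    refine ⟨v + 5 * 3 ^ b * (3 * v + 1) ^ 2 + 25 * 3 ^ (2 * b) * (3 * v + 1) ^ 3, ?_⟩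
    rw [pow_succ 3 b, pow_mul, hv]
    ring

variable {F : Type} [Field F] {ψ : AddChar F ℤ} {γ : Fˣ} {n : ℕ}

theorem gaussPeriod_shift_of_not_dvd (a : ℕ) (hγ : orderOf γ = 15 * 3 ^ a * n) (hn : Odd n)
    (hψ : ∀ x, ψ (x ^ 2) = ψ x) {s : ℕ} (hs : ¬ 3 ^ a ∣ s) :
    gaussPeriod ψ γ (15 * 3 ^ a) n (s + 5 * 3 ^ a) = gaussPeriod ψ γ (15 * 3 ^ a) n s := by
  obtain ⟨i, s', hs', rfl⟩ := Nat.exists_eq_pow_mul_and_not_dvd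
    (n := s) (by rintro rfl; simp at hs) 3 (by norm_num)
  have hi : i < a := by
    by_contra h
    exact hs ((pow_dvd_pow 3 (not_lt.1 h)).mul_right s')
  obtain ⟨b, rfl⟩ := Nat.exists_eq_add_of_lt hi
  obtain ⟨v, hv⟩ := exists_sixteen_pow_three_pow_eq b
  have key : ∀ c, gaussPeriod ψ γ (15 * 3 ^ (i + b + 1)) n
      (3 ^ i * c + 5 * 3 ^ (i + b + 1) * c) =
      gaussPeriod ψ γ (15 * 3 ^ (i + b + 1)) n (3 ^ i * c) := by
    intro c
    rw [← gaussPeriod_two_pow_mul hγ hn hψ (4 * 3 ^ b) (3 ^ i * c), pow_mul,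
      show 2 ^ 4 = 16 by norm_num, hv,
      show (1 + 5 * 3 ^ (b + 1) * (3 * v + 1)) * (3 ^ i * c) =
        3 ^ i * c + 5 * 3 ^ (i + b + 1) * c + 15 * 3 ^ (i + b + 1) * (v * c) by ring,
      gaussPeriod_add_mul hγ]
  have h3 : s' % 3 = 1 ∨ s' % 3 = 2 := by omega
  rcases h3 with h3 | h3
  · obtain ⟨l, hl⟩ : ∃ l, s' = 3 * l + 1 := ⟨s' / 3, by omega⟩
    rw [← key s', ← gaussPeriod_add_mul hγ _ l]
    congr 1
    rw [hl]
    ring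
  · obtain ⟨l, hl⟩ : ∃ l, s' = 3 * l + 2 := ⟨s' / 3, by omega⟩
    have h4 := key (s' * (1 + 5 * 3 ^ (b + 1)))
    rw [show 3 ^ i * (s' * (1 + 5 * 3 ^ (b + 1))) = 3 ^ i * s' + 5 * 3 ^ (i + b + 1) * s' by ring,
      key s'] at h4
    rw [← h4, ← gaussPeriod_add_mul hγ _ (1 + 2 * l + s' * (5 * 3 ^ b))]
    congr 1
    rw [hl]
    ring

theorem gaussPeriod_five (hγ : orderOf γ = 5 * n) (hn : Odd n)
    (hψ : ∀ x, ψ (x ^ 2) = ψ x) (s : ℕ) :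
    gaussPeriod ψ γ 5 n s = if 5 ∣ s then gaussPeriod ψ γ 5 n 0 else gaussPeriod ψ γ 5 n 1 := by
  have h2 := gaussPeriod_two_mul hγ hn hψ 1
  have h4 := gaussPeriod_two_mul hγ hn hψ 2
  have h8 := gaussPeriod_two_mul hγ hn hψ 4
  have h3 := gaussPeriod_mod (ψ := ψ) hγ 8
  norm_num at h2 h4 h8 h3
  rw [← gaussPeriod_mod hγ s]
  have h5 : s % 5 < 5 := Nat.mod_lt _ (by norm_num)
  split_ifs with h
  · rw [Nat.mod_eq_zero_of_dvd h]
  · rw [Nat.dvd_iff_mod_eq_zero] at h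
    interval_cases s % 5
    · exact absurd rfl h
    · rfl
    · exact h2
    · rw [h3, h8, h4, h2]
    · rw [h4, h2]

theorem eq_of_sq_add_two_mul_eq_four {α x y : ℤ}
    (h : α ^ 2 + 2 * (x ^ 2 + y ^ 2 + (x + y) ^ 2) = 4) :
    (α = 2 ∧ x = 0 ∧ y = 0) ∨ (α = -2 ∧ x = 0 ∧ y = 0) ∨
    (α = 0 ∧ x = 1 ∧ y = 0) ∨ (α = 0 ∧ x = -1 ∧ y = 0) ∨
    (α = 0 ∧ x = 0 ∧ y = 1) ∨ (α = 0 ∧ x = 0 ∧ y = -1) ∨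
    (α = 0 ∧ x = 1 ∧ y = -1) ∨ (α = 0 ∧ x = -1 ∧ y = 1) := by
  have hα1 : -2 ≤ α := by nlinarith [sq_nonneg x, sq_nonneg y, sq_nonneg (x + y)]
  have hα2 : α ≤ 2 := by nlinarith [sq_nonneg x, sq_nonneg y, sq_nonneg (x + y)]
  have hx1 : -1 ≤ x := by nlinarith [sq_nonneg α, sq_nonneg y, sq_nonneg (x + y)]
  have hx2 : x ≤ 1 := by nlinarith [sq_nonneg α, sq_nonneg y, sq_nonneg (x + y)]
  have hy1 : -1 ≤ y := by nlinarith [sq_nonneg α, sq_nonneg x, sq_nonneg (x + y)]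
  have hy2 : y ≤ 1 := by nlinarith [sq_nonneg α, sq_nonneg x, sq_nonneg (x + y)]
  interval_cases x <;> interval_cases y <;> interval_cases α <;> simp at h ⊢

/-- The only integral solutions of the moment equations give at most two eigenvalues. -/
theorem two_values_of_moments {A B C P M Y₀ Y₁ ρ q w n X₁ X₂ X₃ X₄ X₅ : ℤ}
    (hρ : ρ ≠ 0) (hq : q = (2 * ρ) ^ 2) (hw : 2 * ρ = 15 * w + 4) (hn : 5 * n + 1 = q)
    (hY : Y₀ + 4 * Y₁ = -1) (hY2 : Y₀ ^ 2 + 4 * Y₁ ^ 2 = 5 * n + 1 - n)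
    (hAB : ρ ∣ A - B) (hPC : ρ ∣ P - C) (hCM : ρ ∣ C - M)
    (hsum : 2 * (A - B) ^ 2 + 4 * ((P - C) ^ 2 + (C - M) ^ 2 + (M - P) ^ 2) = 2 * q)
    (h1 : 3 * X₁ = Y₀ + 2 * A - B - B) (h2 : 3 * X₂ = Y₀ + B - A)
    (h3 : 3 * X₃ = Y₁ + 2 * P - C - M) (h4 : 3 * X₄ = Y₁ + 2 * C - P - M)
    (h5 : 3 * X₅ = Y₁ + 2 * M - P - C) :
    ∃ u v, (X₁ = u ∨ X₁ = v) ∧ (X₂ = u ∨ X₂ = v) ∧ (X₃ = u ∨ X₃ = v) ∧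
      (X₄ = u ∨ X₄ = v) ∧ (X₅ = u ∨ X₅ = v) := by
  have hY1 : (10 * Y₁ + 2) ^ 2 = (4 * ρ) ^ 2 := by
    obtain rfl : Y₀ = -1 - 4 * Y₁ := by linarith
    linear_combination 5 * hY2 + 4 * hn + 4 * hq
  have hY1' : 5 * Y₁ = -1 - 2 * ρ := by
    rcases sq_eq_sq_iff_eq_or_eq_neg.1 hY1 with h | h <;> omega
  obtain ⟨α, hα⟩ := hAB
  obtain ⟨x, hx⟩ := hPC
  obtain ⟨y, hy⟩ := hCM
  have hMP : M - P = ρ * (-(x + y)) := by linear_combination -hx - hy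
  have hnorm : α ^ 2 + 2 * (x ^ 2 + y ^ 2 + (x + y) ^ 2) = 4 := by
    rw [hα, hx, hy, hMP, hq] at hsum
    have h0 : (2 * ρ ^ 2) * (α ^ 2 + 2 * (x ^ 2 + y ^ 2 + (x + y) ^ 2)) = (2 * ρ ^ 2) * 4 := by
      linear_combination hsum
    exact mul_left_cancel₀ (by positivity) h0
  clear hsum hY2 hY1 hq hn hMP
  have hcases := eq_of_sq_add_two_mul_eq_four hnorm
  clear hnorm
  obtain ⟨z, rfl⟩ : ∃ z, w = 2 * z := ⟨w / 2, by omega⟩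
  obtain rfl : ρ = 15 * z + 2 := by omega
  obtain rfl : Y₁ = -1 - 6 * z := by omega
  obtain rfl : Y₀ = 3 + 24 * z := by omega
  obtain rfl := eq_add_of_sub_eq hα
  obtain rfl := eq_add_of_sub_eq hx
  obtain rfl := eq_add_of_sub_eq hy
  clear hα hx hy hY hY1' hw
  by_cases hX : X₃ = X₁
  · refine ⟨X₁, X₄, Or.inl rfl, ?_, Or.inl hX, Or.inr rfl, ?_⟩ <;>
    rcases hcases with h | h | h | h | h | h | h | h <;> obtain ⟨rfl, rfl, rfl⟩ := h <;> omega
  · refine ⟨X₁, X₃, Or.inl rfl, ?_, Or.inr rfl, ?_, ?_⟩ <;>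
    rcases hcases with h | h | h | h | h | h | h | h <;> obtain ⟨rfl, rfl, rfl⟩ := h <;> omega

theorem two_values_of_sequence {b : ℕ → ℤ} {Y₀ Y₁ ρ q w n : ℤ}
    (hρ : ρ ≠ 0) (hq : q = (2 * ρ) ^ 2) (hw : 2 * ρ = 15 * w + 4) (hn : 5 * n + 1 = q)
    (hY : Y₀ + 4 * Y₁ = -1) (hY2 : Y₀ ^ 2 + 4 * Y₁ ^ 2 = 5 * n + 1 - n)
    (hb15 : ∀ e, b (e + 15) = b e) (hb2 : ∀ e, b (2 * e) = b e)
    (hbd : ∀ e, ρ ∣ b e - b (e + 5))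
    (hsum : ∑ e ∈ Finset.range 15, (b e - b (e + 5)) ^ 2 = 2 * q)
    (hX : ∀ e, ∃ X, 3 * X = (if 5 ∣ e then Y₀ else Y₁) + (2 * b e - b (e + 5) - b (e + 10))) :
    ∃ u v, ∀ e S, 3 * S = (if 5 ∣ e then Y₀ else Y₁) + (2 * b e - b (e + 5) - b (e + 10)) →
      S = u ∨ S = v := by
  have e10 : b 10 = b 5 := hb2 5
  have e2 : b 2 = b 1 := hb2 1
  have e4 : b 4 = b 1 := (hb2 2).trans e2
  have e8 : b 8 = b 1 := (hb2 4).trans e4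
  have e14 : b 14 = b 7 := hb2 7
  have e13 : b 13 = b 7 := ((hb15 13).symm.trans (hb2 14)).trans e14
  have e11 : b 11 = b 7 := ((hb15 11).symm.trans (hb2 13)).trans e13
  have e6 : b 6 = b 3 := hb2 3
  have e12 : b 12 = b 3 := (hb2 6).trans e6
  have e9 : b 9 = b 3 := ((hb15 9).symm.trans (hb2 12)).trans e12
  have h15 := hb15 0
  have h16 := hb15 1
  have h17 := hb15 2
  have h18 := hb15 3
  have h19 := hb15 4
  norm_num at h15 h16 h17 h18 h19
  obtain ⟨X₁, h1⟩ := hX 0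
  obtain ⟨X₂, h2⟩ := hX 5
  obtain ⟨X₃, h3⟩ := hX 1
  obtain ⟨X₄, h4⟩ := hX 3
  obtain ⟨X₅, h5⟩ := hX 7
  have d0 := hbd 0
  have d1 := hbd 1
  have d6 := hbd 6
  norm_num [Finset.sum_range_succ, e2, e4, e6, e8, e9, e10, e11, e12, e13, e14, h15, h16, h17, h18,
    h19] at hsum h1 h2 h3 h4 h5 d0 d1 d6
  obtain ⟨u, v, H1, H2, H3, H4, H5⟩ := two_values_of_moments
    (A := b 0) (B := b 5) (P := b 1) (C := b 3) (M := b 7) (X₁ := X₁) (X₂ := X₂) (X₃ := X₃)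
    (X₄ := X₄) (X₅ := X₅) hρ hq hw hn hY hY2 d0 d1 d6 (by linarith) (by linarith) (by linarith)
    (by linarith) (by linarith) (by linarith)
  clear hsum d0 d1 d6 hq hw hn hY hY2 hρ hbd hX
  have hbmod : ∀ e k, b (e + 15 * k) = b e := by
    intro e k
    induction k with
    | zero => rfl
    | succ k ih => rw [← ih, ← hb15 (e + 15 * k)]; rfl
  refine ⟨u, v, fun e S h => ?_⟩
  obtain ⟨r, k, hr, rfl⟩ : ∃ r k, r < 15 ∧ e = r + 15 * k :=
    ⟨e % 15, e / 15, Nat.mod_lt _ (by norm_num), (Nat.mod_add_div e 15).symm⟩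
  have hdvd : 5 ∣ r + 15 * k ↔ 5 ∣ r := Nat.dvd_add_left (by omega)
  rw [add_right_comm r _ 5, add_right_comm r _ 10, hbmod, hbmod, hbmod] at h
  simp only [hdvd] at h
  clear hdvd
  have hS : S = X₁ ∨ S = X₂ ∨ S = X₃ ∨ S = X₄ ∨ S = X₅ := by
    clear H1 H2 H3 H4 H5
    interval_cases r <;>
      norm_num [e2, e4, e6, e8, e9, e10, e11, e12, e13, e14, h15, h16, h17, h18, h19,
        hb15 5, hb15 6, hb15 7, hb15 8, hb15 9] at h <;> omega
  rcases hS with rfl | rfl | rfl | rfl | rfl <;> assumption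

theorem three_mul_sum_gaussPeriod_of_eq (a : ℕ) (hγ : orderOf γ = 15 * 3 ^ a * n) (hn : Odd n)
    (hψ : ∀ x, ψ (x ^ 2) = ψ x) {s i₀ e : ℕ} (hi₀ : i₀ < 3 ^ a) (he : s + 5 * i₀ = 3 ^ a * e) :
    3 * ∑ i ∈ Finset.range (3 ^ a), gaussPeriod ψ γ (15 * 3 ^ a) n (s + 5 * i) =
      gaussPeriod ψ γ 5 (3 * 3 ^ a * n) s +
      (2 * gaussPeriod ψ γ (15 * 3 ^ a) n (3 ^ a * e) -
        gaussPeriod ψ γ (15 * 3 ^ a) n (3 ^ a * (e + 5)) -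
        gaussPeriod ψ γ (15 * 3 ^ a) n (3 ^ a * (e + 10))) := by
  have hcop : Nat.Coprime 5 (3 ^ a) := Nat.Coprime.pow_right a (by norm_num)
  have hshift := fun {s} => gaussPeriod_shift_of_not_dvd a hγ hn hψ (s := s)
  set T := 3 ^ a with hT
  set p := gaussPeriod ψ γ (15 * T) n with hp
  have hfive : gaussPeriod ψ γ 5 (3 * T * n) s = ∑ i ∈ Finset.range (3 * T), p (s + 5 * i) := by
    rw [gaussPeriod, sum_range_mul_eq]
    refine Finset.sum_congr rfl fun i _ => Finset.sum_congr rfl fun t _ => ?_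
    congr 2
    ring
  have hsplit : ∑ i ∈ Finset.range (3 * T), p (s + 5 * i) = ∑ i ∈ Finset.range T,
      (p (s + 5 * i) + p (s + 5 * i + 5 * T) + p (s + 5 * i + 10 * T)) := by
    rw [show 3 * T = T + T + T by ring, Finset.sum_range_add, Finset.sum_range_add,
      Finset.sum_add_distrib, Finset.sum_add_distrib]
    congr 1
    · congr 1
      refine Finset.sum_congr rfl fun i _ => ?_
      congr 1
      ring
    · refine Finset.sum_congr rfl fun i _ => ?_
      congr 1
      ring
  have hmain : 3 * ∑ i ∈ Finset.range T, p (s + 5 * i) - gaussPeriod ψ γ 5 (3 * T * n) s =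
      ∑ i ∈ Finset.range T,
        (2 * p (s + 5 * i) - p (s + 5 * i + 5 * T) - p (s + 5 * i + 10 * T)) := by
    rw [hfive, hsplit, Finset.mul_sum, ← Finset.sum_sub_distrib]
    exact Finset.sum_congr rfl fun i _ => by ring
  have hsingle : ∑ i ∈ Finset.range T,
      (2 * p (s + 5 * i) - p (s + 5 * i + 5 * T) - p (s + 5 * i + 10 * T)) =
      2 * p (s + 5 * i₀) - p (s + 5 * i₀ + 5 * T) - p (s + 5 * i₀ + 10 * T) := by
    refine Finset.sum_eq_single i₀ ?_ fun h => absurd (Finset.mem_range.2 hi₀) h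
    intro i hi hne
    have hnd : ¬ T ∣ s + 5 * i := by
      intro h
      apply hne
      have h1 : s + 5 * i ≡ s + 5 * i₀ [MOD T] :=
        (Nat.modEq_zero_iff_dvd.2 h).trans (Nat.modEq_zero_iff_dvd.2 ⟨e, he⟩).symm
      have h2 := Nat.ModEq.cancel_left_of_coprime (Nat.coprime_comm.1 hcop)
        (Nat.ModEq.add_left_cancel' s h1)
      exact Nat.ModEq.eq_of_lt_of_lt h2 (Finset.mem_range.1 hi) hi₀
    have hz : p (s + 5 * i + 5 * T) = p (s + 5 * i) := hshift hnd
    have hz2 : p (s + 5 * i + 5 * T + 5 * T) = p (s + 5 * i + 5 * T) :=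
      hshift fun h => hnd ((Nat.dvd_add_left (dvd_mul_left T 5)).1 h)
    rw [show s + 5 * i + 10 * T = s + 5 * i + 5 * T + 5 * T by ring, hz2, hz]
    ring
  rw [hsingle, he, show T * e + 5 * T = T * (e + 5) by ring,
    show T * e + 10 * T = T * (e + 10) by ring] at hmain
  linarith

theorem exists_add_five_mul_eq (a s : ℕ) :
    ∃ i₀ < 3 ^ a, ∃ e, s + 5 * i₀ = 3 ^ a * e ∧ (5 ∣ s ↔ 5 ∣ e) := by
  have hcop : Nat.Coprime 5 (3 ^ a) := Nat.Coprime.pow_right a (by norm_num)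
  have hne : NeZero (3 ^ a) := ⟨by positivity⟩
  obtain ⟨i₀, hi₀, e, he⟩ : ∃ i₀ < 3 ^ a, 3 ^ a ∣ s + 5 * i₀ := by
    refine ⟨((-s : ZMod (3 ^ a)) * (5 : ZMod (3 ^ a))⁻¹).val, ZMod.val_lt _, ?_⟩
    rw [← ZMod.natCast_eq_zero_iff]
    have h5 := ZMod.coe_mul_inv_eq_one 5 hcop
    push_cast at h5 ⊢
    rw [ZMod.natCast_zmod_val]
    linear_combination (-s : ZMod (3 ^ a)) * h5
  refine ⟨i₀, hi₀, e, he, ?_⟩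
  rw [← Nat.dvd_add_left (dvd_mul_right 5 i₀), he, hcop.dvd_mul_left]

theorem exists_two_values [Fintype F] [CharP F 2] (a : ℕ) (hF : Fintype.card F = 2 ^ (4 * 3 ^ a))
    (hγ : orderOf γ = 15 * 3 ^ a * n) (hcard : Fintype.card F = 15 * 3 ^ a * n + 1) :
    ∃ u v : ℤ, ∀ s, ∑ i ∈ Finset.range (3 ^ a),
        gaussPeriod (traceChar hF) γ (15 * 3 ^ a) n (s + 5 * i) = u ∨
      ∑ i ∈ Finset.range (3 ^ a),
        gaussPeriod (traceChar hF) γ (15 * 3 ^ a) n (s + 5 * i) = v := by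
  have hTpos : 0 < 3 ^ a := by positivity
  have hψ1 : traceChar hF ≠ 1 := traceChar_ne_one hF (by omega)
  have hψ2 := traceChar_sq hF
  have hqeven : Even (2 ^ (4 * 3 ^ a)) := (even_two).pow_of_ne_zero (by omega)
  have hodd : Odd (15 * 3 ^ a * n) := by
    rw [← hF, hcard] at hqeven
    exact Nat.not_even_iff_odd.1 (Nat.even_add_one.1 hqeven)
  have hn : Odd n := (Nat.odd_mul.1 hodd).2
  have hn0 : 0 < n := hn.pos
  have hγ5 : orderOf γ = 5 * (3 * 3 ^ a * n) := by rw [hγ]; ring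
  have hcard5 : Fintype.card F = 5 * (3 * 3 ^ a * n) + 1 := by rw [hcard]; ring
  have hn5 : Odd (3 * 3 ^ a * n) := by
    rw [hγ5] at hγ
    exact (Nat.odd_mul.1 (hγ ▸ hodd)).2
  have hdvd := two_pow_dvd_gaussPeriod_sub a hF hγ hcard hn0
  have hshift : ∀ {s}, ¬ 3 ^ a ∣ s → _ := gaussPeriod_shift_of_not_dvd a hγ hn hψ2
  have hmom := sum_sq_gaussPeriod_sub_shift hγ hcard hψ1 (by positivity) hn0 (d := 5 * 3 ^ a)
    (fun h => absurd (Nat.le_of_dvd (by positivity) h) (by omega))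
  have hY := sum_gaussPeriod hγ5 hcard5 hψ1
  have hY2 := sum_gaussPeriod_sq hγ5 hcard5 hψ1 (by norm_num) hn5.pos
  have h3X := fun {s i₀ e} => three_mul_sum_gaussPeriod_of_eq a hγ hn hψ2
    (s := s) (i₀ := i₀) (e := e)
  have hfive := gaussPeriod_five hγ5 hn5 hψ2
  set p := gaussPeriod (traceChar hF) γ (15 * 3 ^ a) n with hp
  set p₅ := gaussPeriod (traceChar hF) γ 5 (3 * 3 ^ a * n) with hp₅
  obtain ⟨b, hb⟩ : ∃ b : ℕ → ℤ, ∀ e, b e = p (3 ^ a * e) := ⟨_, fun _ => rfl⟩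
  have hb15 : ∀ e, b (e + 15) = b e := by
    intro e
    rw [hb, hb, hp, ← gaussPeriod_add_mul hγ (3 ^ a * e) 1]
    congr 1
    ring
  have hb2 : ∀ e, b (2 * e) = b e := by
    intro e
    rw [hb, hb, hp, ← gaussPeriod_two_mul hγ hn hψ2 (3 ^ a * e)]
    congr 1
    ring
  simp only [← hb] at h3X
  have hmom' : ∑ e ∈ Finset.range 15, (b e - b (e + 5)) ^ 2 = 2 * 2 ^ (4 * 3 ^ a) := by
    have hc : ((15 * 3 ^ a * n + 1 : ℕ) : ℤ) = ((2 ^ (4 * 3 ^ a) : ℕ) : ℤ) := by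
      rw [← hF, hcard]
    push_cast at hc hmom
    rw [← hc, ← hmom, mul_comm 15 (3 ^ a), sum_range_mul_eq]
    symm
    refine (Finset.sum_eq_single 0 ?_ ?_).trans ?_
    rotate_left 2
    · refine Finset.sum_congr rfl fun e _ => ?_
      rw [hb, hb]
      ring_nf
    · intro c hc hc0
      refine Finset.sum_eq_zero fun t _ => ?_
      rw [hshift, sub_self, zero_pow two_ne_zero]
      intro h
      have := (Nat.dvd_add_left (dvd_mul_right _ t)).1 h
      exact hc0 (Nat.eq_zero_of_dvd_of_lt this (Finset.mem_range.1 hc))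
    · intro h
      exact absurd (Finset.mem_range.2 hTpos) h
  have hbd : ∀ e, (2 : ℤ) ^ (2 * 3 ^ a - 1) ∣ b e - b (e + 5) := by
    intro e
    have := hdvd (3 ^ a * e)
    rwa [show 3 ^ a * e + 5 * 3 ^ a = 3 ^ a * (e + 5) by ring, ← hb, ← hb] at this
  have hρ2 : (2 : ℤ) * 2 ^ (2 * 3 ^ a - 1) = 2 ^ (2 * 3 ^ a) := by
    rw [← pow_succ']
    congr 1
    omega
  obtain ⟨w, hw⟩ : ∃ w : ℤ, (2 : ℤ) * 2 ^ (2 * 3 ^ a - 1) = 15 * w + 4 := by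
    obtain ⟨k, hk⟩ : Odd (3 ^ a) := Odd.pow (by decide)
    have h1 : (15 : ℤ) ∣ 16 ^ k - 1 := by
      simpa using sub_dvd_pow_sub_pow (16 : ℤ) 1 k
    obtain ⟨c, hc⟩ := h1
    refine ⟨4 * c, ?_⟩
    rw [hρ2, hk, show 2 * (2 * k + 1) = 4 * k + 2 by ring, pow_add, pow_mul]
    norm_num
    linear_combination 4 * hc
  have hXval : ∀ e, ∃ X : ℤ, 3 * X = (if 5 ∣ e then p₅ 0 else p₅ 1) +
      (2 * b e - b (e + 5) - b (e + 10)) := by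
    intro e
    refine ⟨_, (h3X (s := 3 ^ a * e) hTpos rfl).trans ?_⟩
    rw [hfive]
    simp only [(Nat.Coprime.pow_right a (by norm_num : Nat.Coprime 5 3)).dvd_mul_left]
  have hfv : p₅ 2 = p₅ 1 ∧ p₅ 3 = p₅ 1 ∧ p₅ 4 = p₅ 1 := by
    refine ⟨?_, ?_, ?_⟩ <;> rw [hfive] <;> norm_num
  obtain ⟨f2, f3, f4⟩ := hfv
  simp only [Finset.sum_range_succ, Finset.sum_range_zero, f2, f3, f4] at hY hY2
  have hqn : (5 * (3 * 3 ^ a * n : ℕ) + 1 : ℤ) = 2 ^ (4 * 3 ^ a) := by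
    have := hcard5.symm.trans hF
    exact_mod_cast this
  obtain ⟨u, v, huv⟩ := two_values_of_sequence (b := b) (Y₀ := p₅ 0) (Y₁ := p₅ 1)
    (n := (3 * 3 ^ a * n : ℕ)) (ρ := 2 ^ (2 * 3 ^ a - 1)) (w := w) (q := 2 ^ (4 * 3 ^ a))
    (by positivity) (by rw [hρ2, ← pow_mul]; congr 1; ring) hw hqn (by linarith)
    (by push_cast at hY2 ⊢; linarith) hb15 hb2 hbd hmom' hXval
  refine ⟨u, v, fun s => ?_⟩
  obtain ⟨i₀, hi₀, e, he, hse⟩ := exists_add_five_mul_eq a s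
  have h := h3X hi₀ he
  rw [hfive] at h
  simp only [hse] at h
  exact huv e _ h

end TwoValues

section StronglyRegular

variable {F : Type} [Field F] [Fintype F] [CharP F 2]

theorem card_mul_card_filter_add_mem {ψ : AddChar F ℤ} (hψ : ψ ≠ 1) (D : Finset F) (t : F) :
    (Fintype.card F : ℤ) * (D.filter fun d => d + t ∈ D).card =
      ∑ a, (∑ x ∈ D, ψ (a * x)) ^ 2 * ψ (a * t) := by
  have h1 : ∀ a, (∑ x ∈ D, ψ (a * x)) ^ 2 * ψ (a * t) =
      ∑ x ∈ D, ∑ y ∈ D, ψ (a * (x + t + y)) := by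
    intro a
    rw [sq, Finset.sum_mul_sum, Finset.sum_mul]
    refine Finset.sum_congr rfl fun x _ => ?_
    rw [Finset.sum_mul]
    refine Finset.sum_congr rfl fun y _ => ?_
    rw [mul_add, mul_add, AddChar.map_add_eq_mul, AddChar.map_add_eq_mul, mul_right_comm]
  simp only [h1]
  rw [Finset.sum_comm, Finset.card_filter, Nat.cast_sum, Finset.mul_sum]
  refine Finset.sum_congr rfl fun x _ => ?_
  rw [Finset.sum_comm]
  simp only [AddChar.sum_mulShift _ (AddChar.IsPrimitive.of_ne_one hψ), CharTwo.add_eq_zero]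
  rw [← Nat.cast_sum, Finset.sum_ite_eq]
  split_ifs <;> simp

theorem card_mul_indicator {ψ : AddChar F ℤ} (hψ : ψ ≠ 1) (D : Finset F) (t : F) :
    (if t ∈ D then (Fintype.card F : ℤ) else 0) = ∑ a, (∑ x ∈ D, ψ (a * x)) * ψ (a * t) := by
  simp only [Finset.sum_mul, ← AddChar.map_add_eq_mul, ← mul_add]
  rw [Finset.sum_comm]
  simp only [AddChar.sum_mulShift _ (AddChar.IsPrimitive.of_ne_one hψ), CharTwo.add_eq_zero]
  rw [← Nat.cast_sum, Finset.sum_ite_eq']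
  split_ifs <;> simp

/-- If the nontrivial eigenvalues of `D` take at most two values, then the number of
representations of `t ≠ 0` as a difference of elements of `D` depends only on whether `t ∈ D`. -/
theorem card_filter_add_mem_eq {ψ : AddChar F ℤ} (hψ : ψ ≠ 1) {D : Finset F} {u v : ℤ}
    (huv : ∀ a ≠ 0, ∑ x ∈ D, ψ (a * x) = u ∨ ∑ x ∈ D, ψ (a * x) = v) {t t' : F}
    (ht : t ≠ 0) (ht' : t' ≠ 0) (hiff : t ∈ D ↔ t' ∈ D) :
    (D.filter fun d => d + t ∈ D).card = (D.filter fun d => d + t' ∈ D).card := by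
  have key : ∀ s : F, s ≠ 0 → (Fintype.card F : ℤ) * (D.filter fun d => d + s ∈ D).card =
      (u + v) * (if s ∈ D then (Fintype.card F : ℤ) else 0) +
        ((D.card : ℤ) ^ 2 - (u + v) * D.card + u * v) := by
    intro s hs
    have h0 : ∑ a, ψ (a * s) = 0 := by
      rw [AddChar.sum_mulShift _ (AddChar.IsPrimitive.of_ne_one hψ), if_neg hs, Nat.cast_zero]
    have h1 : ∀ a, (∑ x ∈ D, ψ (a * x)) ^ 2 * ψ (a * s) =
        (u + v) * ((∑ x ∈ D, ψ (a * x)) * ψ (a * s)) - u * v * ψ (a * s) +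
          if a = 0 then ((D.card : ℤ) ^ 2 - (u + v) * D.card + u * v) else 0 := by
      intro a
      split_ifs with ha
      · subst ha
        simp
      · rcases huv a ha with h | h <;> rw [h] <;> ring
    rw [card_mul_card_filter_add_mem hψ, Finset.sum_congr rfl fun a _ => h1 a,
      Finset.sum_add_distrib, Finset.sum_sub_distrib, ← Finset.mul_sum, ← Finset.mul_sum, h0,
      ← card_mul_indicator hψ, Finset.sum_ite_eq', if_pos (Finset.mem_univ _)]
    ring
  have hq : (Fintype.card F : ℤ) ≠ 0 := by exact_mod_cast Fintype.card_ne_zero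
  have h := key t ht
  simp only [hiff] at h
  exact_mod_cast mul_left_cancel₀ hq (h.trans (key t' ht').symm)

theorem fromRel_sub_mem_adj {F : Type} [Field F] [CharP F 2] {D : Set F}
    (hD : (0 : F) ∉ D) (x y : F) :
    (SimpleGraph.fromRel fun x y : F => x - y ∈ D).Adj x y ↔ x + y ∈ D := by
  rw [SimpleGraph.fromRel_adj, CharTwo.sub_eq_add, CharTwo.sub_eq_add, add_comm y x, or_self,
    and_iff_right_iff_imp]
  rintro h rfl
  rw [CharTwo.add_self_eq_zero] at h
  exact hD h

theorem isSRGWith_fromRel_sub_mem {ψ : AddChar F ℤ} (hψ : ψ ≠ 1) {D : Set F}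
    (hD : (0 : F) ∉ D) {u v : ℤ} (huv : ∀ a ≠ 0,
      ∑ x ∈ D.toFinset, ψ (a * x) = u ∨ ∑ x ∈ D.toFinset, ψ (a * x) = v) :
    ∃ l m : ℕ, (SimpleGraph.fromRel fun x y : F => x - y ∈ D).IsSRGWith
      (Fintype.card F) D.toFinset.card l m := by
  have hadj := fromRel_sub_mem_adj hD
  have hcommon : ∀ x y,
      Fintype.card ((SimpleGraph.fromRel fun x y : F => x - y ∈ D).commonNeighbors x y) =
        (D.toFinset.filter fun d => d + (x + y) ∈ D.toFinset).card := by
    intro x y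
    rw [← Finset.card_image_of_injective _ (add_right_injective x)]
    refine Fintype.card_of_finset' _ fun z => ?_
    rw [SimpleGraph.mem_commonNeighbors, hadj, hadj]
    simp only [Finset.mem_image, Finset.mem_filter, Set.mem_toFinset]
    constructor
    · rintro ⟨d, ⟨h1, h2⟩, rfl⟩
      rw [← add_assoc, CharTwo.add_self_eq_zero, zero_add]
      exact ⟨h1, by convert h2 using 1; ring⟩
    · rintro ⟨h1, h2⟩
      refine ⟨x + z, ⟨h1, ?_⟩, ?_⟩
      · convert h2 using 1
        linear_combination CharTwo.add_self_eq_zero x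
      · rw [← add_assoc, CharTwo.add_self_eq_zero, zero_add]
  have hconst : ∀ P : Prop, ∃ l, ∀ t : F, t ≠ 0 → (t ∈ D ↔ P) →
      (D.toFinset.filter fun d => d + t ∈ D.toFinset).card = l := by
    intro P
    by_cases h : ∃ t : F, t ≠ 0 ∧ (t ∈ D ↔ P)
    · obtain ⟨t, ht, htP⟩ := h
      refine ⟨_, fun t' ht' ht'P => card_filter_add_mem_eq hψ huv ht' ht ?_⟩
      rw [Set.mem_toFinset, Set.mem_toFinset, ht'P, htP]
    · exact ⟨0, fun t ht htP => absurd ⟨t, ht, htP⟩ h⟩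
  obtain ⟨l, hl⟩ := hconst True
  obtain ⟨m, hm⟩ := hconst False
  refine ⟨l, m, rfl, ?_, ?_, ?_⟩
  · intro x
    rw [← SimpleGraph.card_neighborSet_eq_degree,
      ← Finset.card_image_of_injective _ (add_right_injective x)]
    refine Fintype.card_of_finset' _ fun z => ?_
    rw [SimpleGraph.mem_neighborSet, hadj]
    simp only [Finset.mem_image, Set.mem_toFinset]
    constructor
    · rintro ⟨d, h1, rfl⟩
      rwa [← add_assoc, CharTwo.add_self_eq_zero, zero_add]
    · intro h1
      exact ⟨x + z, h1, by rw [← add_assoc, CharTwo.add_self_eq_zero, zero_add]⟩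
  · intro x y hxy
    have h := (hadj x y).1 hxy
    rw [hcommon]
    exact hl _ (fun h0 => hD (h0 ▸ h)) (iff_true_intro h)
  · intro x y hne hxy
    have h := fun h => hxy ((hadj x y).2 h)
    rw [hcommon]
    exact hm _ (fun h0 => hne (CharTwo.add_eq_zero.1 h0)) (iff_false_intro h)

theorem fromRel_sub_mem_ne_top {D : Set F} (hD : (0 : F) ∉ D)
    (hcard : D.toFinset.card + 1 < Fintype.card F) :
    (SimpleGraph.fromRel fun x y : F => x - y ∈ D) ≠ ⊤ := by
  obtain ⟨x, -, hx⟩ := Finset.exists_mem_notMem_of_card_lt_card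
    (s := insert 0 D.toFinset) (t := Finset.univ)
    ((Finset.card_insert_le _ _).trans_lt (by rwa [Finset.card_univ]))
  rw [Finset.mem_insert, Set.mem_toFinset, not_or] at hx
  intro h
  have h0 : (SimpleGraph.fromRel fun x y : F => x - y ∈ D).Adj x 0 := by
    rw [h]
    exact hx.1
  rw [fromRel_sub_mem_adj hD, add_zero] at h0
  exact hx.2 h0

theorem fromRel_sub_mem_ne_bot {F : Type} [Field F] [CharP F 2] {D : Set F}
    (hD : (0 : F) ∉ D) (hne : D.Nonempty) :
    (SimpleGraph.fromRel fun x y : F => x - y ∈ D) ≠ ⊥ := by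
  obtain ⟨x, hx⟩ := hne
  intro h
  have h0 := (fromRel_sub_mem_adj hD x 0).2 (by rwa [add_zero])
  rw [h] at h0
  exact h0

end StronglyRegular

section CyclotomicUnion

variable {F : Type} [Field F] [Fintype F] {γ : Fˣ} {T n : ℕ}

theorem exists_generator_pow_eq {k : ℕ} (hγ : orderOf γ = k) (hF : Fintype.card F = k + 1)
    {x : F} (hx : x ≠ 0) : ∃ s, x = (γ : F) ^ s := by
  have h := sum_range_generator_pow γ hγ hF fun y => if x = y then 1 else 0
  rw [Finset.sum_ite_eq, if_pos (Finset.mem_univ _), if_neg hx, zero_add] at h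
  obtain ⟨s, -, hs⟩ := Finset.exists_ne_zero_of_sum_ne_zero (h ▸ one_ne_zero)
  exact ⟨s, by_contra fun h => hs (if_neg h)⟩

theorem cyclotomicUnion_injOn {F : Type} [Field F] {γ : Fˣ} {T n : ℕ}
    (hγ : orderOf γ = 15 * T * n) (hT : 0 < T) (c : ℕ) :
    Set.InjOn (fun j : ℕ × ℕ => (γ : F) ^ (5 * j.1 + c + 15 * T * j.2))
      (Finset.range T ×ˢ Finset.range n : Finset (ℕ × ℕ)) := by
  rintro ⟨i, t⟩ hi ⟨i', t'⟩ hi' h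
  simp only [Finset.coe_product, Finset.coe_range, Set.mem_prod, Set.mem_Iio] at hi hi' h
  have h1 : γ ^ (5 * i + c + 15 * T * t) = γ ^ (5 * i' + c + 15 * T * t') := by
    ext
    simpa using h
  rw [pow_eq_pow_iff_modEq, hγ] at h1
  have h2 : 5 * i ≡ 5 * i' [MOD 15 * T] := by
    refine Nat.ModEq.add_right_cancel' c ?_
    have := h1.of_mul_right n
    simpa [Nat.ModEq] using this
  have h3 := Nat.ModEq.eq_of_lt_of_lt h2 (by omega) (by omega)
  obtain rfl : i = i' := by omega
  have h4 := (Nat.ModEq.add_left_cancel' _ h1).mul_left_cancel' (by omega)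
  rw [Nat.ModEq.eq_of_lt_of_lt h4 hi.2 hi'.2]

theorem cyclotomicUnion_toFinset (hγ : orderOf γ = 15 * T * n) (hn : 0 < n) {c : ℕ} {D : Set F}
    (hD : D = {x : F | ∃ i < T, ∃ t : ℕ, x = (γ : F) ^ (5 * i + c + 15 * T * t)}) :
    D.toFinset = (Finset.range T ×ˢ Finset.range n).image
      fun j : ℕ × ℕ => (γ : F) ^ (5 * j.1 + c + 15 * T * j.2) := by
  ext x
  simp only [hD, Set.mem_toFinset, Set.mem_ofPred_eq, Finset.mem_image, Finset.mem_product,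
    Finset.mem_range, Prod.exists]
  constructor
  · rintro ⟨i, hi, t, rfl⟩
    refine ⟨i, t % n, ⟨hi, Nat.mod_lt _ hn⟩, ?_⟩
    rw [← generator_pow_add_mul hγ _ (t / n)]
    congr 1
    have := Nat.mod_add_div t n
    linear_combination 15 * T * this
  · rintro ⟨i, t, ⟨hi, -⟩, rfl⟩
    exact ⟨i, hi, t, rfl⟩

theorem sum_cyclotomicUnion (hγ : orderOf γ = 15 * T * n) (hT : 0 < T) (hn : 0 < n) {c : ℕ}
    {D : Set F} (hD : D = {x : F | ∃ i < T, ∃ t : ℕ, x = (γ : F) ^ (5 * i + c + 15 * T * t)})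
    (ψ : AddChar F ℤ) (s : ℕ) :
    ∑ x ∈ D.toFinset, ψ ((γ : F) ^ s * x) =
      ∑ i ∈ Finset.range T, gaussPeriod ψ γ (15 * T) n (s + c + 5 * i) := by
  rw [cyclotomicUnion_toFinset hγ hn hD, Finset.sum_image (cyclotomicUnion_injOn hγ hT c),
    Finset.sum_product]
  refine Finset.sum_congr rfl fun i _ => Finset.sum_congr rfl fun t _ => ?_
  rw [← pow_add]
  congr 2
  ring

end CyclotomicUnion

/-- Each `Cay(F_q, D_k)` is a strongly regular graph of degree `(q-1)/15`,
where `q = 2^{4*3^(m-1)}`, `N = 3^m*5`. -/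
theorem cayley_srg_example_8
    (m N q : ℕ) (hm : 1 ≤ m)
    (hN : N = 3 ^ m * 5) (hq : q = 2 ^ (4 * 3 ^ (m - 1)))
    (F : Type) [Field F] [Fintype F] (hF : Fintype.card F = q)
    (γ : Fˣ) (hγ : orderOf γ = q - 1)
    (D : ℕ → Set F)
    (hD : ∀ k, D k = {x : F | ∃ i < 3 ^ (m - 1), ∃ t : ℕ,
        x = ((γ : F)) ^ (5 * i + k * 3 ^ (m - 1) + N * t)}) :
    ∀ k ≤ 14,
      SimpleGraph.fromRel (fun x y : F => x - y ∈ D k) ≠ ⊤ ∧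
      SimpleGraph.fromRel (fun x y : F => x - y ∈ D k) ≠ ⊥ ∧
      ∃ l u : ℕ, (SimpleGraph.fromRel (fun x y : F => x - y ∈ D k)).IsSRGWith
        q ((q - 1) / 15) l u := by
  intro k _
  obtain ⟨a, rfl⟩ : ∃ a, m = a + 1 := ⟨m - 1, by omega⟩
  rw [Nat.add_sub_cancel] at hq
  specialize hD k
  rw [Nat.add_sub_cancel, show N = 15 * 3 ^ a by rw [hN]; ring] at hD
  obtain ⟨w, hw⟩ := exists_sixteen_pow_three_pow_eq a
  have hqn : q = 15 * 3 ^ a * (3 * w + 1) + 1 := by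
    rw [hq, pow_mul, show 2 ^ 4 = 16 by norm_num, hw]
    ring
  set n := 3 * w + 1 with hn
  have hn0 : 0 < n := by omega
  have hT : 0 < 3 ^ a := by positivity
  have hγ' : orderOf γ = 15 * 3 ^ a * n := by rw [hγ, hqn, Nat.add_sub_cancel]
  have hF' : Fintype.card F = 2 ^ (4 * 3 ^ a) := hF.trans hq
  have hchar : CharP F 2 := by
    obtain ⟨p, hp⟩ := CharP.exists F
    obtain ⟨f, hpp, hcard⟩ := FiniteField.card F p
    have h2 : p ∣ 2 ^ (4 * 3 ^ a) := by
      rw [← hF', hcard]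
      exact dvd_pow_self p f.ne_zero
    rwa [(Nat.prime_dvd_prime_iff_eq hpp Nat.prime_two).1 (hpp.dvd_of_dvd_pow h2)] at hp
  have hcard := hF.trans hqn
  obtain ⟨u, v, huv⟩ := exists_two_values a hF' hγ' hcard
  have hψ := traceChar_ne_one hF' (by omega)
  have h0 : (0 : F) ∉ D k := by
    rw [hD]
    rintro ⟨i, -, t, h⟩
    exact pow_ne_zero _ γ.ne_zero h.symm
  have hDcard : (D k).toFinset.card = 3 ^ a * n := by
    rw [cyclotomicUnion_toFinset hγ' hn0 hD,
      Finset.card_image_of_injOn (cyclotomicUnion_injOn hγ' hT _), Finset.card_product,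
      Finset.card_range, Finset.card_range]
  have hpos : 0 < 3 ^ a * n := by positivity
  have hassoc : 15 * 3 ^ a * n = 15 * (3 ^ a * n) := mul_assoc _ _ _
  refine ⟨fromRel_sub_mem_ne_top h0 ?_, fromRel_sub_mem_ne_bot h0 ?_, ?_⟩
  · rw [hDcard, hcard, hassoc]
    omega
  · rw [← Set.toFinset_nonempty, ← Finset.card_pos, hDcard]
    exact hpos
  · have hdeg : (q - 1) / 15 = (D k).toFinset.card := by
      rw [hDcard, hqn, hassoc]
      omega
    rw [hdeg, ← hF]
    refine isSRGWith_fromRel_sub_mem hψ h0 (u := u) (v := v) fun x hx => ?_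
    obtain ⟨s, rfl⟩ := exists_generator_pow_eq hγ' hcard hx
    rw [sum_cyclotomicUnion hγ' hT hn0 hD]
    exact huv _
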